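/- Let n ≥ 5 and let P₀ : Fin n → ℝ² be a configuration of n labeled points (injective, in general position); call a subset H ⊆ Fin n an important set if H is the extreme set of some configuration Q on Fin n with the same radial system as P₀. If some important set H has cardinality at least 4, then H is the only important set: every important set equals H. -/

import Mathlib

noncomputable def det2 (v w : ℝ × ℝ) : ℝ := v.1 * w.2 - v.2 * w.1

noncomputable def chi {α : Type*} (P : α → ℝ × ℝ) (i j k : α) : ℝ :=
  Real.sign (det2 (P j - P i) (P k - P i))

def GenPos {α : Type*} (P : α → ℝ × ℝ) : Prop :=
  ∀ i j k : α, i ≠ j → i ≠ k → j ≠ k → chi P i j k ≠ 0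

def Ccw {α : Type*} (P : α → ℝ × ℝ) (i j k l : α) : Prop :=
  (chi P i j k = 1 ∧ chi P i k l = 1) ∨
  (chi P i k l = 1 ∧ chi P i l j = 1) ∨
  (chi P i l j = 1 ∧ chi P i j k = 1)

def Admissible {α : Type*} (i j k l : α) : Prop :=
  i ≠ j ∧ i ≠ k ∧ i ≠ l ∧ j ≠ k ∧ j ≠ l ∧ k ≠ l

def SameRadial {α : Type*} (P Q : α → ℝ × ℝ) : Prop :=
  ∀ i j k l : α, Admissible i j k l → (Ccw P i j k l ↔ Ccw Q i j k l)

def SameUndirected {α : Type*} (P Q : α → ℝ × ℝ) : Prop :=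
  ∀ i : α, (∀ j k l : α, Admissible i j k l → (Ccw Q i j k l ↔ Ccw P i j k l)) ∨
           (∀ j k l : α, Admissible i j k l → (Ccw Q i j k l ↔ Ccw P i l k j))

def ExtremeSet {α : Type*} (P : α → ℝ × ℝ) : Set α :=
  {i | P i ∉ convexHull ℝ (P '' {j | j ≠ i})}

def Important {n : ℕ} (P₀ : Fin n → ℝ × ℝ) (H : Set (Fin n)) : Prop :=
  ∃ Q : Fin n → ℝ × ℝ, Function.Injective Q ∧ GenPos Q ∧ SameRadial P₀ Q ∧ ExtremeSet Q = H

def lineThrough (p q : ℝ × ℝ) : Set (ℝ × ℝ) := {x | ∃ t : ℝ, x = p + t • (q - p)}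

/-- Twice the signed area of the triangle `P i, P j, P k`. -/
noncomputable def area {α : Type*} (P : α → ℝ × ℝ) (i j k : α) : ℝ :=
  det2 (P j - P i) (P k - P i)

/-- `P p` lies in the interior of the counterclockwise triangle `P a, P b, P c`. -/
def InTriangle {α : Type*} (P : α → ℝ × ℝ) (p a b c : α) : Prop :=
  0 < area P p a b ∧ 0 < area P p b c ∧ 0 < area P p c a

/-- `P a, P b, P c, P d` is a convex quadrilateral in counterclockwise order. -/
def ConvexQuad {α : Type*} (P : α → ℝ × ℝ) (a b c d : α) : Prop :=
  0 < area P a b c ∧ 0 < area P b c d ∧ 0 < area P c d a ∧ 0 < area P d a b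

section

variable {α : Type*} {P Q : α → ℝ × ℝ} {p a b c d : α}

lemma area_rotate (P : α → ℝ × ℝ) (i j k : α) : area P i j k = area P j k i := by
  simp only [area, det2, Prod.fst_sub, Prod.snd_sub]; ring

lemma area_swap (P : α → ℝ × ℝ) (i j k : α) : area P i j k = -area P i k j := by
  simp only [area, det2, Prod.fst_sub, Prod.snd_sub]; ring

lemma area_swap_left (P : α → ℝ × ℝ) (i j k : α) : area P i j k = -area P j i k := by
  simp only [area, det2, Prod.fst_sub, Prod.snd_sub]; ring

lemma area_self_left (P : α → ℝ × ℝ) (i k : α) : area P i i k = 0 := by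
  simp [area, det2]

lemma area_self_right (P : α → ℝ × ℝ) (i j : α) : area P i j j = 0 := by
  simp only [area, det2]; ring

lemma area_self_outer (P : α → ℝ × ℝ) (i j : α) : area P i j i = 0 := by
  simp [area, det2]

lemma area_split (P : α → ℝ × ℝ) (p a b c : α) :
    area P a b c = area P p a b + area P p b c + area P p c a := by
  simp only [area, det2, Prod.fst_sub, Prod.snd_sub]; ring

lemma area_mul_area (P : α → ℝ × ℝ) (p a b c x y : α) :
    area P a b c * area P p x y =
      area P p b c * area P a x y + area P p c a * area P b x y + area P p a b * area P c x y := by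
  simp only [area, det2, Prod.fst_sub, Prod.snd_sub]; ring

lemma chi_eq_one_iff (P : α → ℝ × ℝ) (i j k : α) : chi P i j k = 1 ↔ 0 < area P i j k := by
  unfold chi area
  rcases lt_trichotomy (det2 (P j - P i) (P k - P i)) 0 with h | h | h
  · rw [Real.sign_of_neg h]; constructor <;> intro h' <;> linarith
  · rw [h]; simp
  · rw [Real.sign_of_pos h]; simp [h]

lemma Admissible.of_area_pos (h1 : 0 < area P a b c) (h2 : 0 < area P b c d)
    (h3 : 0 < area P c d a) : Admissible a b c d := by
  refine ⟨?_, ?_, ?_, ?_, ?_, ?_⟩ <;> rintro rfl <;>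
    simp_all [area_self_left, area_self_right, area_self_outer]

lemma SameRadial.symm (h : SameRadial P Q) : SameRadial Q P := fun i j k l hi =>
  (h i j k l hi).symm

lemma SameRadial.trans {R : α → ℝ × ℝ} (h : SameRadial P Q) (h' : SameRadial Q R) :
    SameRadial P R := fun i j k l hi => (h i j k l hi).trans (h' i j k l hi)

lemma GenPos.area_ne_zero (hP : GenPos P) (hab : a ≠ b) (hac : a ≠ c) (hbc : b ≠ c) :
    area P a b c ≠ 0 := by
  intro h
  apply hP a b c hab hac hbc
  unfold area at h
  simp [chi, h]

lemma ConvexQuad.rotate (h : ConvexQuad P a b c d) : ConvexQuad P b c d a :=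
  ⟨h.2.1, h.2.2.1, h.2.2.2, h.1⟩

lemma ConvexQuad.ccw (h : ConvexQuad P a b c d) : Ccw P a b c d := by
  left
  rw [chi_eq_one_iff, chi_eq_one_iff, area_rotate P a c d]
  exact ⟨h.1, h.2.2.1⟩

/-- The radial system determines the convex quadrilaterals and their orientation. -/
lemma ConvexQuad.of_sameRadial (h : ConvexQuad P a b c d) (hPQ : SameRadial P Q) :
    ConvexQuad Q a b c d := by
  have key : ∀ {a b c d : α}, ConvexQuad P a b c d → Ccw Q a b c d := fun h =>
    (hPQ _ _ _ _ (.of_area_pos h.1 h.2.1 h.2.2.1)).1 h.ccw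
  have ha := key h
  have hb := key h.rotate
  have hc := key h.rotate.rotate
  have hd := key h.rotate.rotate.rotate
  simp only [Ccw, chi_eq_one_iff] at ha hb hc hd
  rw [area_rotate Q a c d, area_swap_left Q a d b] at ha
  rw [← area_rotate Q a b d, ← area_rotate Q d a b, area_swap_left Q b a c] at hb
  rw [area_rotate Q c a b, area_swap_left Q c b d] at hc
  rw [area_rotate Q d b c, area_swap_left Q d c a] at hd
  simp only [ConvexQuad]
  grind

lemma InTriangle.rotate (h : InTriangle P p a b c) : InTriangle P p b c a :=
  ⟨h.2.1, h.2.2, h.1⟩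

lemma InTriangle.area_pos (h : InTriangle P p a b c) : 0 < area P a b c := by
  rw [area_split P p]; linarith [h.1, h.2.1, h.2.2]

lemma InTriangle.notMem_extremeSet (h : InTriangle P p a b c) : p ∉ ExtremeSet P := by
  have h0 := h.area_pos
  obtain ⟨h1, h2, h3⟩ := h
  have hne : a ≠ p ∧ b ≠ p ∧ c ≠ p := by
    refine ⟨?_, ?_, ?_⟩ <;> rintro rfl <;>
      simp_all [area_self_left, area_self_outer]
  have hsum := area_split P p a b c
  simp only [ExtremeSet, Set.mem_ofPred_eq, not_not]
  have hmem : ∀ i, i ≠ p → P i ∈ convexHull ℝ (P '' {j | j ≠ p}) := fun i hi =>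
    subset_convexHull ℝ _ ⟨i, hi, rfl⟩
  have h0' := h0.ne'
  have hcomb : P p = (area P p b c / area P a b c) • P a + (area P p c a / area P a b c) • P b
      + (area P p a b / area P a b c) • P c := by
    ext
    · simp only [Prod.fst_add, Prod.smul_fst, smul_eq_mul]
      field_simp
      simp only [area, det2, Prod.fst_sub, Prod.snd_sub]; ring
    · simp only [Prod.snd_add, Prod.smul_snd, smul_eq_mul]
      field_simp
      simp only [area, det2, Prod.fst_sub, Prod.snd_sub]; ring
  have hmem3 := (convex_convexHull ℝ (P '' {j | j ≠ p})).sum_mem (t := Finset.univ)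
    (w := ![area P p b c / area P a b c, area P p c a / area P a b c, area P p a b / area P a b c])
    (z := ![P a, P b, P c])
    (by intro i _; fin_cases i <;> simp <;> positivity)
    (by simp [Fin.sum_univ_three]; field_simp; linarith)
    (by intro i _; fin_cases i <;> simp <;> exact hmem _ (by tauto))
  rw [hcomb]
  simpa [Fin.sum_univ_three] using hmem3

/-- A counterclockwise triangle of extreme points is completed by any further extreme point to a
convex quadrilateral. -/
lemma GenPos.convexQuad_of_extreme (hP : GenPos P) (had : a ≠ d) (hbd : b ≠ d) (hcd : c ≠ d)
    (habc : 0 < area P a b c) (ha : a ∈ ExtremeSet P) (hb : b ∈ ExtremeSet P)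
    (hc : c ∈ ExtremeSet P) (hd : d ∈ ExtremeSet P) :
    ConvexQuad P a b c d ∨ ConvexQuad P b c a d ∨ ConvexQuad P c a b d := by
  have hne : a ≠ b ∧ a ≠ c ∧ b ≠ c := by
    refine ⟨?_, ?_, ?_⟩ <;> rintro rfl <;>
      simp_all [area_self_left, area_self_right, area_self_outer]
  have aux : ∀ {a b c : α}, a ≠ d → b ≠ d → b ≠ c → a ≠ b → 0 < area P a b c →
      a ∈ ExtremeSet P → c ∈ ExtremeSet P → area P d c a < 0 → ConvexQuad P a b c d := by
    intro a b c had hbd hbc hab habc ha hc hlt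
    have na : ¬ InTriangle P a b c d := fun h => h.notMem_extremeSet ha
    have nc : ¬ InTriangle P c a b d := fun h => h.notMem_extremeSet hc
    have hcd : c ≠ d := by rintro rfl; simp [area_self_left] at hlt
    have x1 := hP.area_ne_zero hbc hbd hcd
    have x2 := hP.area_ne_zero had.symm hbd.symm hab
    have hcda : 0 < area P c d a := by rw [area_swap_left]; linarith
    refine ⟨habc, ?_, hcda, ?_⟩
    · by_contra hcon
      refine nc ⟨?_, ?_, ?_⟩
      · rwa [area_rotate]
      · rw [area_swap_left]; linarith [lt_of_le_of_ne (not_lt.1 hcon) x1]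
      · exact hcda
    · by_contra hcon
      refine na ⟨habc, ?_, ?_⟩
      · rwa [area_rotate]
      · rw [area_swap_left]; linarith [lt_of_le_of_ne (not_lt.1 hcon) x2]
  have habc' := habc
  rw [area_rotate] at habc'
  have habc'' := habc'
  rw [area_rotate] at habc''
  by_contra! hcon
  obtain ⟨h1, h2, h3⟩ := hcon
  have y1 := mt (aux had hbd hne.2.2 hne.1 habc ha hc) h1
  have y2 := mt (aux hbd hcd hne.2.1.symm hne.2.2 habc' hb ha) h2
  have y3 := mt (aux hcd had hne.1 hne.2.1.symm habc'' hc hb) h3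
  have x1 := hP.area_ne_zero had.symm hbd.symm hne.1
  have x2 := hP.area_ne_zero hbd.symm hcd.symm hne.2.2
  have x3 := hP.area_ne_zero hcd.symm had.symm hne.2.1.symm
  exact InTriangle.notMem_extremeSet (P := P) (p := d) (a := a) (b := b) (c := c)
    ⟨lt_of_le_of_ne (not_lt.1 y2) x1.symm, lt_of_le_of_ne (not_lt.1 y3) x2.symm,
      lt_of_le_of_ne (not_lt.1 y1) x3.symm⟩ hd

/-- A point inside a convex quadrilateral, in the triangle cut off by one side and the two
diagonals, is not extreme in any configuration with the same radial system. -/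
lemma ConvexQuad.notMem_extremeSet_of_cell (h : ConvexQuad P a b c d) (hPQ : SameRadial P Q)
    (hQ : GenPos Q) (hab : 0 < area P p a b) (hbc : 0 < area P p b c)
    (hcd : 0 < area P p c d) (hda : 0 < area P p d a) (hca : 0 < area P p c a)
    (hbd : 0 < area P p b d) : p ∉ ExtremeSet Q := by
  have h1 : ConvexQuad P p c d a := by
    refine ⟨hcd, h.2.2.1, ?_, ?_⟩
    · rwa [← area_rotate]
    · rwa [area_rotate]
  have h2 : ConvexQuad P p b c d := by
    refine ⟨hbc, h.2.1, ?_, ?_⟩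
    · rwa [← area_rotate]
    · rwa [area_rotate]
  have q1 := h1.of_sameRadial hPQ
  have q2 := h2.of_sameRadial hPQ
  have q := h.of_sameRadial hPQ
  have hpa : p ≠ a := by rintro rfl; simp [area_self_left] at hab
  have hpb : p ≠ b := by rintro rfl; simp [area_self_outer] at hab
  have hne : a ≠ b := by rintro rfl; simp [area_self_right] at hab
  have hca' : 0 < area Q p c a := by
    rw [area_rotate, area_rotate]; exact q1.2.2.2
  refine InTriangle.notMem_extremeSet (a := a) (b := b) (c := c) ⟨?_, q2.1, hca'⟩
  by_contra hcon
  have hlt := lt_of_le_of_ne (not_lt.1 hcon) (hQ.area_ne_zero hpa hpb hne)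
  have q3 : ConvexQuad Q a p b c := by
    refine ⟨?_, q2.1, ?_, ?_⟩
    · rw [area_swap_left]; linarith
    · rw [← area_rotate]; exact q.1
    · rwa [← area_rotate]
  have h3 := (q3.of_sameRadial hPQ.symm).1
  rw [area_swap_left] at h3
  linarith

/-- A point inside a triangle that is part of a convex quadrilateral is not extreme in any
configuration with the same radial system. -/
lemma ConvexQuad.notMem_extremeSet_of_inTriangle (h : ConvexQuad P a b c d)
    (hp : InTriangle P p a b c) (hPQ : SameRadial P Q) (hP : GenPos P) (hQ : GenPos Q)
    (hpd : p ≠ d) : p ∉ ExtremeSet Q := by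
  obtain ⟨hab, hbc, hca⟩ := hp
  have had : 0 < area P a c d := by rw [area_rotate]; exact h.2.2.1
  have hcd : 0 < area P p c d := by
    have := area_mul_area P p a b c c d
    rw [area_self_left] at this
    refine pos_of_mul_pos_right (a := area P a b c) ?_ h.1.le
    rw [this]
    have := mul_pos hbc had
    have := mul_pos hca h.2.1
    linarith
  have hda : 0 < area P p d a := by
    have := area_mul_area P p a b c d a
    rw [area_self_outer, area_rotate P b d a] at this
    refine pos_of_mul_pos_right (a := area P a b c) ?_ h.1.le
    rw [this]
    have := mul_pos hab h.2.2.1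
    have := mul_pos hca h.2.2.2
    linarith
  have hpb : p ≠ b := by rintro rfl; simp [area_self_left] at hbc
  have hbd : b ≠ d := by rintro rfl; simpa [area_self_outer] using h.2.1
  rcases lt_or_gt_of_ne (hP.area_ne_zero hpb hpd hbd) with hlt | hgt
  · refine h.rotate.notMem_extremeSet_of_cell hPQ hQ hbc hcd hda hab ?_ hca
    rw [area_swap]; linarith
  · exact h.notMem_extremeSet_of_cell hPQ hQ hab hbc hcd hda hca hgt

lemma convexHull_extremeSet [Finite α] (hinj : Function.Injective P) :
    convexHull ℝ (Set.range P) = convexHull ℝ (P '' ExtremeSet P) := by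
  have hsub : (convexHull ℝ (Set.range P)).extremePoints ℝ ⊆ P '' ExtremeSet P := by
    intro x hx
    obtain ⟨i, rfl⟩ := extremePoints_convexHull_subset hx
    refine ⟨i, fun hi => ?_, rfl⟩
    have hconv := ((convex_convexHull ℝ _).mem_extremePoints_iff_convex_sdiff.1 hx).2
    refine (convexHull_min ?_ hconv hi).2 rfl
    rintro _ ⟨j, hj, rfl⟩
    exact ⟨subset_convexHull ℝ _ ⟨j, rfl⟩, fun h => hj (hinj h)⟩
  refine Set.Subset.antisymm ?_ (convexHull_mono (Set.image_subset_range _ _))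
  rw [← closure_convexHull_extremePoints ((Set.finite_range P).isCompact_convexHull ℝ)
    (convex_convexHull ℝ _)]
  refine closure_minimal (convexHull_mono hsub) ?_
  exact (Set.toFinite _).isClosed_convexHull ℝ

lemma area_of_combination {u v w : ℝ} (h : P p = u • P a + v • P b + w • P c)
    (h1 : u + v + w = 1) : area P p a b = w * area P a b c := by
  obtain rfl : u = 1 - v - w := by linarith
  simp only [area, det2, h, Prod.fst_sub, Prod.snd_sub, Prod.fst_add, Prod.snd_add, Prod.smul_fst,
    Prod.smul_snd, smul_eq_mul]
  ring

lemma inTriangle_of_combination {u v w : ℝ} (hu : 0 < u) (hv : 0 < v) (hw : 0 < w)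
    (h : P p = u • P a + v • P b + w • P c) (h1 : u + v + w = 1) (habc : 0 < area P a b c) :
    InTriangle P p a b c := by
  refine ⟨?_, ?_, ?_⟩
  · rw [area_of_combination h h1]; positivity
  · rw [area_of_combination (u := v) (v := w) (w := u) (c := a) (by rw [h]; abel) (by linarith),
      ← area_rotate]
    positivity
  · rw [area_of_combination (u := w) (v := u) (w := v) (c := b) (by rw [h]; abel) (by linarith),
      area_rotate]
    positivity

/-- **Carathéodory's theorem** for configurations in general position. -/
lemma GenPos.exists_inTriangle_extreme [Finite α] (hinj : Function.Injective P) (hP : GenPos P)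
    (hp : p ∉ ExtremeSet P) :
    ∃ a ∈ ExtremeSet P, ∃ b ∈ ExtremeSet P, ∃ c ∈ ExtremeSet P, InTriangle P p a b c := by
  have hmem : P p ∈ convexHull ℝ (P '' ExtremeSet P) := by
    rw [← convexHull_extremeSet hinj]
    exact subset_convexHull ℝ _ ⟨p, rfl⟩
  obtain ⟨ι, _, z, w, hz, hind, hw, hw1, hsum⟩ := eq_pos_convex_span_of_mem_convexHull hmem
  have hcard : Fintype.card ι ≤ 3 := by
    have h := hind.card_le_finrank_succ
    have h' := Submodule.finrank_le (vectorSpan ℝ (Set.range z))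
    simp only [Module.finrank_prod, Module.finrank_self] at h'
    omega
  choose f hf hfz using fun i => hz ⟨i, rfl⟩
  have hfinj : Function.Injective f := fun i j hij => hind.injective (by rw [← hfz, ← hfz, hij])
  have hfp : ∀ i, p ≠ f i := fun i h => hp (h ▸ hf i)
  simp only [← hfz] at hsum
  obtain ⟨e⟩ : Nonempty (Fin (Fintype.card ι) ≃ ι) := ⟨(Fintype.equivFin ι).symm⟩
  rw [← e.sum_comp] at hsum hw1
  generalize Fintype.card ι = m at hcard e
  have he : ∀ {i j : Fin m}, i ≠ j → f (e i) ≠ f (e j) := fun h h' => h (e.injective (hfinj h'))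
  interval_cases m
  · simp at hw1
  · simp only [Fin.sum_univ_one] at hw1 hsum
    rw [hw1, one_smul] at hsum
    exact absurd (hinj hsum).symm (hfp _)
  · simp only [Fin.sum_univ_two] at hw1 hsum
    refine absurd ?_ (hP.area_ne_zero (hfp (e 0)) (hfp (e 1)) (he (by decide)))
    rw [area_of_combination (u := w (e 0)) (v := w (e 1)) (w := 0) (c := p) (by simp [hsum])
      (by rw [add_zero, hw1]), zero_mul]
  · simp only [Fin.sum_univ_three] at hw1 hsum
    have hne := hP.area_ne_zero (he (i := 0) (j := 1) (by decide)) (he (j := 2) (by decide))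
      (he (by decide))
    rcases lt_or_gt_of_ne hne with hlt | hgt
    · refine ⟨_, hf (e 0), _, hf (e 2), _, hf (e 1), inTriangle_of_combination (hw (e 0))
        (hw (e 2)) (hw (e 1)) (by rw [← hsum]; abel) (by linarith) ?_⟩
      rw [area_swap]; linarith
    · exact ⟨_, hf (e 0), _, hf (e 1), _, hf (e 2), inTriangle_of_combination (hw (e 0))
        (hw (e 1)) (hw (e 2)) hsum.symm hw1 hgt⟩

end

/-- an important set of cardinality at least 4 is the unique
important set. -/
theorem big_important_set_unique {n : ℕ} (hn : 5 ≤ n)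
    (P₀ : Fin n → ℝ × ℝ)
    (hinj : Function.Injective P₀) (hgp : GenPos P₀)
    (H : Set (Fin n)) (hH : Important P₀ H) (hcard : 4 ≤ H.ncard) :
    ∀ H' : Set (Fin n), Important P₀ H' → H' = H := by
  rintro _ ⟨Q, hQinj, hQ, hPQ, rfl⟩
  obtain ⟨P, hPinj, hP, hPP, rfl⟩ := hH
  have hPQ := hPP.symm.trans hPQ
  have hsub : ExtremeSet Q ⊆ ExtremeSet P := by
    intro p hpQ
    by_contra hpP
    obtain ⟨a, ha, b, hb, c, hc, hp⟩ := hP.exists_inTriangle_extreme hPinj hpP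
    obtain ⟨d, hd, hdn⟩ : ∃ d ∈ ExtremeSet P, d ∉ ({a, b, c} : Finset (Fin n)) := by
      by_contra! hcon
      have h1 := Set.ncard_le_ncard (t := (({a, b, c} : Finset (Fin n)) : Set (Fin n))) hcon
      rw [Set.ncard_coe_finset] at h1
      have h2 := Finset.card_le_three (a := a) (b := b) (c := c)
      omega
    simp only [Finset.mem_insert, Finset.mem_singleton, not_or] at hdn
    have hpd : p ≠ d := fun h => hpP (h ▸ hd)
    rcases hP.convexQuad_of_extreme (Ne.symm hdn.1) (Ne.symm hdn.2.1) (Ne.symm hdn.2.2)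
      hp.area_pos ha hb hc hd with h | h | h
    · exact h.notMem_extremeSet_of_inTriangle hp hPQ hP hQ hpd hpQ
    · exact h.notMem_extremeSet_of_inTriangle hp.rotate hPQ hP hQ hpd hpQ
    · exact h.notMem_extremeSet_of_inTriangle hp.rotate.rotate hPQ hP hQ hpd hpQ
  refine hsub.antisymm fun d hd => ?_
  by_contra hdQ
  obtain ⟨a, ha, b, hb, c, hc, hp⟩ := hQ.exists_inTriangle_extreme hQinj hdQ
  have had : a ≠ d := fun h => hdQ (h ▸ ha)
  have hbd : b ≠ d := fun h => hdQ (h ▸ hb)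
  have hcd : c ≠ d := fun h => hdQ (h ▸ hc)
  have habc := hp.area_pos
  obtain ⟨h1, h2, h3⟩ := hp
  have hne : a ≠ b ∧ a ≠ c ∧ b ≠ c := by
    refine ⟨?_, ?_, ?_⟩ <;> rintro rfl <;>
      simp_all [area_self_left, area_self_right, area_self_outer]
  rcases lt_or_gt_of_ne (hP.area_ne_zero hne.1 hne.2.1 hne.2.2) with hlt | hgt
  · have hacb : 0 < area P a c b := by rw [area_swap]; linarith
    have h0 : ¬ 0 < area Q a c b := by rw [area_swap]; linarith
    rcases hP.convexQuad_of_extreme had hcd hbd hacb (hsub ha) (hsub hc) (hsub hb) hd with h | h | h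
    · exact h0 (h.of_sameRadial hPQ).1
    · rw [area_rotate] at h0; exact h0 (h.of_sameRadial hPQ).1
    · rw [← area_rotate] at h0; exact h0 (h.of_sameRadial hPQ).1
  · rcases hP.convexQuad_of_extreme had hbd hcd hgt (hsub ha) (hsub hb) (hsub hc) hd with h | h | h
    · have := (h.of_sameRadial hPQ).2.2.1
      rw [area_swap_left] at this; linarith
    · have := (h.of_sameRadial hPQ).2.2.1
      rw [area_swap_left] at this; linarith
    · have := (h.of_sameRadial hPQ).2.2.1
      rw [area_swap_left] at this; linarith
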